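/- arXiv:2312.12335 — 2 statements merged into one kernel-verified Lean document; each statement's English description precedes it below -/
import Mathlib

section
/- (Main theorem, upper bound on the generic rank.) Let G act on ℂ^D with ℂ^D an irreducible G-module, and let V ⊆ ℂ^D be an irreducible Zariski-closed G-invariant cone with V ≠ {0} and dim V = N for a natural number N. Then for every m ≥ 1 with N * m ≥ D + N^2, the m-th secant variety σ_m V equals all of ℂ^D. -/
noncomputable section

/-- The Zariski topology on `ι → ℂ`: a set is closed iff it is the common zero locus
of a family of polynomials in `MvPolynomial ι ℂ`. -/
def zt (ι : Type*) : TopologicalSpace (ι → ℂ) :=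
  TopologicalSpace.generateFrom
    { U | ∃ f : MvPolynomial ι ℂ, U = { x | MvPolynomial.eval x f ≠ 0 } }

def zIsClosed {ι : Type*} (S : Set (ι → ℂ)) : Prop := @IsClosed _ (zt ι) S

def zIsIrreducible {ι : Type*} (S : Set (ι → ℂ)) : Prop := @IsIrreducible _ (zt ι) S

def zClosure {ι : Type*} (S : Set (ι → ℂ)) : Set (ι → ℂ) := @closure _ (zt ι) S

/-- The topological Krull dimension of `S` (with the subspace Zariski topology):
the supremum of lengths of chains of irreducible closed subsets. -/
def zDim {ι : Type*} (S : Set (ι → ℂ)) : WithBot ℕ∞ :=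
  @topologicalKrullDim ↥S (TopologicalSpace.induced Subtype.val (zt ι))

/-- The `m`-th secant variety: the Zariski closure of the set of sums of `m` points of `V`. -/
def secant {ι : Type*} (m : ℕ) (V : Set (ι → ℂ)) : Set (ι → ℂ) :=
  zClosure { p | ∃ x : Fin m → (ι → ℂ), (∀ i, x i ∈ V) ∧ p = ∑ i, x i }

/-- `ℂ^D` is an irreducible `G`-module (through `ρ`). -/
def IsIrreducibleGModule {D : ℕ} {G : Type*} [Group G]
    (ρ : G →* ((Fin D → ℂ) ≃ₗ[ℂ] (Fin D → ℂ))) : Prop :=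
  1 ≤ D ∧ ∀ W : Submodule ℂ (Fin D → ℂ),
    (∀ g : G, ∀ x ∈ W, ρ g x ∈ W) → W = ⊥ ∨ W = ⊤

open MvPolynomial
open scoped Topology

/-- A derivation of an algebra `K` over a polynomial ring obeys the chain rule. -/
lemma derivation_algebraMap_mvPolynomial {k K σ : Type*} [CommRing k] [Fintype σ]
    [CommRing K] [Algebra k K] [Algebra (MvPolynomial σ k) K]
    [IsScalarTower k (MvPolynomial σ k) K] (δ : Derivation k K K) (f : MvPolynomial σ k) :
    δ (algebraMap _ K f) =
      ∑ l, algebraMap _ K (pderiv l f) * δ (algebraMap _ K (X l : MvPolynomial σ k)) := by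
  classical
  induction f using MvPolynomial.induction_on with
  | C a =>
    have : algebraMap (MvPolynomial σ k) K (C a) = algebraMap k K a := by
      rw [IsScalarTower.algebraMap_apply k (MvPolynomial σ k) K, MvPolynomial.algebraMap_eq]
    simp [this]
  | add p q hp hq => simp [hp, hq, add_mul, Finset.sum_add_distrib]
  | mul_X p n hp =>
    simp only [map_mul, Derivation.leibniz, smul_eq_mul, map_add, hp, add_mul,
      Finset.sum_add_distrib, pderiv_X, Pi.single_apply, Finset.mul_sum]
    congr 1
    · simp [apply_ite (algebraMap (MvPolynomial σ k) K), Finset.sum_ite_eq]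
    · exact Finset.sum_congr rfl fun l _ => by ring

/-- If `A` is an integral domain, integral over a polynomial subring in characteristic zero, then
the partial derivatives of the polynomial ring extend to the fraction field of `A`. -/
lemma exists_derivation_dual {k A K σ : Type*} [Field k] [CharZero k] [CommRing A] [IsDomain A]
    [Algebra k A] [Field K] [Algebra A K] [IsFractionRing A K] [Algebra k K] [IsScalarTower k A K]
    [DecidableEq σ]
    (g : MvPolynomial σ k →ₐ[k] A) (hinj : Function.Injective g) (hint : g.IsIntegral) (i : σ) :
    ∃ δ : Derivation k K K, ∀ j, δ (algebraMap A K (g (X j))) = if i = j then 1 else 0 := by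
  let S := MvPolynomial σ k
  let : Algebra S A := g.toRingHom.toAlgebra
  let : Algebra S K := ((algebraMap A K).comp g.toRingHom).toAlgebra
  have : IsScalarTower S A K := .of_algebraMap_eq fun _ => rfl
  have : IsScalarTower k S A := .of_algebraMap_eq fun x => (g.commutes x).symm
  have : IsScalarTower k S K := .of_algebraMap_eq fun x => by
    rw [IsScalarTower.algebraMap_apply S A K, ← IsScalarTower.algebraMap_apply k S A,
      ← IsScalarTower.algebraMap_apply k A K]
  have : Algebra.IsIntegral S A := ⟨hint⟩
  have hinjA : Function.Injective (algebraMap S A) := hinj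
  have hinjK : Function.Injective (algebraMap S K) :=
    (IsFractionRing.injective A K).comp hinjA
  have : FaithfulSMul S K := (faithfulSMul_iff_algebraMap_injective S K).2 hinjK
  let F := FractionRing S
  let : Algebra F K := FractionRing.liftAlgebra S K
  have : IsScalarTower S F K := inferInstance
  have : Algebra.IsAlgebraic S A := inferInstance
  have : Algebra.IsAlgebraic A K := IsLocalization.isAlgebraic K (nonZeroDivisors A)
  have : FaithfulSMul S A := (faithfulSMul_iff_algebraMap_injective S A).2 hinjA
  have : Algebra.IsAlgebraic S K := Algebra.IsAlgebraic.trans S A K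
  have : Algebra.IsAlgebraic F K :=
    (IsFractionRing.comap_isAlgebraic_iff (A := S) (K := F) (C := K)).1 inferInstance
  have : CharZero F := inferInstance
  have : Algebra.IsSeparable F K := inferInstance
  have : Algebra.FormallyEtale F K := Algebra.FormallyEtale.of_isSeparable F K
  have : Algebra.FormallyEtale S F := Algebra.FormallyEtale.of_isLocalization (nonZeroDivisors S)
  have : Algebra.FormallyEtale S K := Algebra.FormallyEtale.comp S F K
  let e := KaehlerDifferential.tensorKaehlerEquivOfFormallyEtale k S K
  let b := (KaehlerDifferential.mvPolynomialBasis k σ).baseChange K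
  let φ : Ω[K⁄k] →ₗ[K] K := (b.coord i) ∘ₗ e.symm.toLinearMap
  refine ⟨φ.compDer (KaehlerDifferential.D k K), fun j => ?_⟩
  have h1 : algebraMap A K (g (X j)) = algebraMap S K (X j) := rfl
  have h2 : e.symm (KaehlerDifferential.D k K (algebraMap S K (X j))) = b j := by
    rw [KaehlerDifferential.tensorKaehlerEquivOfFormallyEtale_symm_D_algebraMap]
    simp [b, S]
  change b.coord i (e.symm (KaehlerDifferential.D k K (algebraMap A K (g (X j))))) = _
  rw [h1, h2]
  simp [Finsupp.single_apply, eq_comm]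

/-- Polynomial vector fields tangent to an affine variety `I` that is finite over affine space:
they are dual, up to a common factor `h ∉ I`, to functions `q j`. -/
lemma exists_tangent_fields {k σ τ : Type*} [Field k] [CharZero k] [Fintype σ] [Finite τ]
    [DecidableEq τ]
    (I : Ideal (MvPolynomial σ k)) [I.IsPrime]
    (g : MvPolynomial τ k →ₐ[k] MvPolynomial σ k ⧸ I) (hinj : Function.Injective g)
    (hint : g.IsIntegral) :
    ∃ (w : τ → σ → MvPolynomial σ k) (q : τ → MvPolynomial σ k) (h : MvPolynomial σ k),
      h ∉ I ∧ (∀ i, ∀ f ∈ I, ∑ l, w i l * pderiv l f ∈ I) ∧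
      ∀ i j, ∑ l, w i l * pderiv l (q j) - (if i = j then h else 0) ∈ I := by
  let P := MvPolynomial σ k
  let A := P ⧸ I
  let K := FractionRing A
  have : IsScalarTower P A K := inferInstance
  have : IsScalarTower k A K := inferInstance
  have : IsScalarTower k P K := inferInstance
  choose δ hδ using fun i => exists_derivation_dual (K := K) g hinj hint i
  obtain ⟨b, hb⟩ := IsLocalization.exist_integer_multiples_of_finite (nonZeroDivisors A)
    (fun p : τ × σ => δ p.1 (algebraMap P K (X p.2)))
  choose c hc using hb
  choose w hw using fun p => Ideal.Quotient.mk_surjective (I := I) (c p)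
  obtain ⟨h, hh⟩ := Ideal.Quotient.mk_surjective (I := I) (b : A)
  choose q hq using fun j => Ideal.Quotient.mk_surjective (I := I) (g (X j))
  have hinjK : Function.Injective (algebraMap A K) := IsFractionRing.injective A K
  have key : ∀ i f, algebraMap P K (∑ l, w (i, l) * pderiv l f) =
      algebraMap P K h * δ i (algebraMap P K f) := by
    intro i f
    rw [derivation_algebraMap_mvPolynomial, map_sum, Finset.mul_sum]
    refine Finset.sum_congr rfl fun l _ => ?_
    have h1 : algebraMap P K (w (i, l)) = algebraMap P K h * δ i (algebraMap P K (X l)) := by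
      rw [IsScalarTower.algebraMap_apply P A K, IsScalarTower.algebraMap_apply P A K h,
        show algebraMap P A (w (i, l)) = c (i, l) from hw _, hc,
        show algebraMap P A h = b from hh, Algebra.smul_def]
    rw [map_mul, h1]; ring
  have hmem : ∀ f : P, algebraMap P K f = 0 ↔ f ∈ I := by
    intro f
    rw [IsScalarTower.algebraMap_apply P A K, map_eq_zero_iff _ hinjK]
    exact Ideal.Quotient.eq_zero_iff_mem
  refine ⟨fun i l => w (i, l), q, h, ?_, fun i f hf => ?_, fun i j => ?_⟩
  · intro hI
    have : (b : A) = 0 := by rw [← hh]; exact Ideal.Quotient.eq_zero_iff_mem.2 hI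
    exact nonZeroDivisors.ne_zero b.2 this
  · rw [← hmem, key, (hmem f).2 hf]; simp
  · rw [← hmem, map_sub, key]
    have : algebraMap P K (q j) = algebraMap A K (g (X j)) := by
      rw [IsScalarTower.algebraMap_apply P A K, ← hq]; rfl
    rw [this, hδ]
    split_ifs <;> simp

/-- A set of polynomials that is stable under partial derivatives and contains no nonzero constant
contains no nonzero polynomial. -/
lemma eq_zero_of_pderiv_stable {k σ : Type*} [Field k] [CharZero k]
    (J : Set (MvPolynomial σ k)) (hJ : ∀ f ∈ J, ∀ l, pderiv l f ∈ J)
    (hC : ∀ c, C c ∈ J → c = 0) {f : MvPolynomial σ k} (hf : f ∈ J) : f = 0 := by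
  classical
  suffices H : ∀ n, ∀ f ∈ J, f.totalDegree ≤ n → f = 0 from H _ f hf le_rfl
  have hconst : ∀ f ∈ J, f.totalDegree = 0 → f = 0 := by
    intro f hf h0
    rw [totalDegree_eq_zero_iff_eq_C] at h0
    rw [h0] at hf ⊢
    rw [hC _ hf, C_0]
  intro n
  induction n with
  | zero => exact fun f hf h => hconst f hf (by lia)
  | succ n ih =>
    intro f hf hdeg
    refine hconst f hf ?_
    have hz : ∀ l, pderiv l f = 0 := by
      refine fun l => ih _ (hJ f hf l) (Finset.sup_le fun m hm => ?_)
      rw [mem_support_iff, coeff_pderiv] at hm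
      have h1 : m + Finsupp.single l 1 ∈ f.support :=
        mem_support_iff.2 (left_ne_zero_of_mul hm)
      have h2 := (le_totalDegree h1).trans hdeg
      rw [Finsupp.sum_add_index' (by simp) (by simp)] at h2
      simpa using h2
    refine Nat.le_zero.1 (Finset.sup_le fun m hm => ?_)
    by_cases hm0 : m = 0
    · simp [hm0]
    · obtain ⟨l, hl⟩ := Finsupp.ne_iff.1 hm0
      obtain ⟨m', rfl⟩ : ∃ m', m = m' + Finsupp.single l 1 :=
        ⟨m - Finsupp.single l 1, (tsub_add_cancel_of_le
          (Finsupp.single_le_iff.2 (Nat.one_le_iff_ne_zero.2 hl))).symm⟩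
      have h3 := coeff_pderiv (i := l) f m'
      rw [hz l, coeff_zero, eq_comm, mul_eq_zero] at h3
      exact absurd (h3.resolve_right (by exact_mod_cast Nat.succ_ne_zero (m' l)))
        (mem_support_iff.1 hm)

section Zariski

variable {ι σ : Type*}

lemma isOpen_zt_ne_zero (f : MvPolynomial σ ℂ) : IsOpen[zt σ] {x | eval x f ≠ 0} :=
  TopologicalSpace.isOpen_generateFrom_of_mem ⟨f, rfl⟩

lemma exists_eval_ne_zero_of_isOpen_zt {U : Set (σ → ℂ)} (hU : IsOpen[zt σ] U) {x : σ → ℂ}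
    (hx : x ∈ U) : ∃ f : MvPolynomial σ ℂ, eval x f ≠ 0 ∧ ∀ y, eval y f ≠ 0 → y ∈ U := by
  induction hU with
  | basic s hs =>
    obtain ⟨f, rfl⟩ := hs
    exact ⟨f, hx, fun _ h => h⟩
  | univ => exact ⟨1, by simp, fun _ _ => trivial⟩
  | inter s t _ _ ihs iht =>
    obtain ⟨f, hf, hf'⟩ := ihs hx.1
    obtain ⟨g, hg, hg'⟩ := iht hx.2
    refine ⟨f * g, by simp [hf, hg], fun y hy => ?_⟩
    rw [map_mul] at hy
    exact ⟨hf' y (left_ne_zero_of_mul hy), hg' y (right_ne_zero_of_mul hy)⟩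
  | sUnion S _ ih =>
    obtain ⟨s, hs, hxs⟩ := hx
    obtain ⟨f, hf, hf'⟩ := ih s hs hxs
    exact ⟨f, hf, fun y hy => ⟨s, hs, hf' y hy⟩⟩

lemma exists_mem_vanishingIdeal_of_notMem {Z : Set (σ → ℂ)} (hZ : zIsClosed Z) {x : σ → ℂ}
    (hx : x ∉ Z) : ∃ f ∈ vanishingIdeal ℂ Z, eval x f ≠ 0 := by
  obtain ⟨f, hf, hf'⟩ := exists_eval_ne_zero_of_isOpen_zt
    (@IsClosed.isOpen_compl _ (zt σ) Z hZ) (x := x) hx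
  refine ⟨f, fun y hy => ?_, hf⟩
  by_contra h
  exact hf' y (by simpa [aeval_eq_eval] using h) hy

lemma mem_vanishingIdeal_iff_eval {V : Set (σ → ℂ)} {f : MvPolynomial σ ℂ} :
    f ∈ vanishingIdeal ℂ V ↔ ∀ x ∈ V, eval x f = 0 := by
  simp [mem_vanishingIdeal_iff, aeval_eq_eval]

lemma vanishingIdeal_isPrime {V : Set (σ → ℂ)} (hV : zIsIrreducible V) :
    (vanishingIdeal ℂ V : Ideal (MvPolynomial σ ℂ)).IsPrime := by
  refine ⟨fun h => ?_, fun {f g} hfg => ?_⟩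
  · obtain ⟨x, hx⟩ := hV.1
    have := mem_vanishingIdeal_iff_eval.1 ((Ideal.eq_top_iff_one _).1 h) x hx
    simp at this
  · by_contra hcon
    simp only [mem_vanishingIdeal_iff_eval, not_or, not_forall] at hcon
    obtain ⟨⟨x, hx, hfx⟩, ⟨y, hy, hgy⟩⟩ := hcon
    obtain ⟨z, hz, hfz, hgz⟩ := hV.2 _ _ (isOpen_zt_ne_zero f) (isOpen_zt_ne_zero g)
      ⟨x, hx, hfx⟩ ⟨y, hy, hgy⟩
    have := mem_vanishingIdeal_iff_eval.1 hfg z hz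
    rw [map_mul, mul_eq_zero] at this
    exact this.elim hfz hgz

/-- If the coordinate ring of a closed set `V` is integral over a polynomial ring in `s`
variables, then `dim V ≤ s`. -/
lemma zDim_le_of_isIntegral {V : Set (σ → ℂ)} (hV : zIsClosed V) {s : ℕ}
    (g : MvPolynomial (Fin s) ℂ →ₐ[ℂ] MvPolynomial σ ℂ ⧸ vanishingIdeal ℂ V)
    (hg : g.IsIntegral) : zDim V ≤ s := by
  let S := MvPolynomial (Fin s) ℂ
  let I : Ideal (MvPolynomial σ ℂ) := vanishingIdeal ℂ V
  let A := MvPolynomial σ ℂ ⧸ I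
  let _ : Algebra S A := g.toRingHom.toAlgebra
  have : Algebra.IsIntegral S A := ⟨hg⟩
  let τ : TopologicalSpace V := TopologicalSpace.induced Subtype.val (zt σ)
  have hdim : ringKrullDim S = s := by
    rw [MvPolynomial.ringKrullDim_of_isNoetherianRing, ringKrullDim_eq_zero_of_field]
    simp
  have himg : ∀ Z : TopologicalSpace.IrreducibleCloseds V,
      zIsIrreducible (Subtype.val '' (Z : Set V)) ∧ zIsClosed (Subtype.val '' (Z : Set V)) := by
    intro Z
    let _ := zt σ
    exact ⟨Z.isIrreducible'.image _ continuous_induced_dom.continuousOn,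
      hV.isClosedMap_subtype_val _ Z.isClosed'⟩
  let p : TopologicalSpace.IrreducibleCloseds V → Ideal (MvPolynomial σ ℂ) :=
    fun Z => vanishingIdeal ℂ (Subtype.val '' (Z : Set V))
  have hp : ∀ Z, (p Z).IsPrime := fun Z => vanishingIdeal_isPrime (himg Z).1
  have hIp : ∀ Z, I ≤ p Z := fun Z => vanishingIdeal_anti_mono (by simp)
  have hanti : ∀ Z Z', Z < Z' → p Z' < p Z := by
    intro Z Z' h
    refine lt_of_le_not_ge (vanishingIdeal_anti_mono (Set.image_mono h.le)) fun hle => ?_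
    obtain ⟨x, hx', hx⟩ := Set.exists_of_ssubset h
    obtain ⟨f, hf, hfx⟩ := exists_mem_vanishingIdeal_of_notMem (himg Z).2
      (x := (x : σ → ℂ)) (by simpa using hx)
    exact hfx (mem_vanishingIdeal_iff_eval.1 (hle hf) _ ⟨x, hx', rfl⟩)
  have hcomap : ∀ Z, (Ideal.map (Ideal.Quotient.mk I) (p Z)).comap (Ideal.Quotient.mk I) = p Z :=
    fun Z => by
      rw [Ideal.comap_map_of_surjective _ Ideal.Quotient.mk_surjective, sup_eq_left,
        ← RingHom.ker_eq_comap_bot, Ideal.mk_ker]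
      exact hIp Z
  have hq : ∀ Z, (Ideal.map (Ideal.Quotient.mk I) (p Z)).IsPrime := fun Z => by
    have := hp Z
    exact Ideal.map_isPrime_of_surjective Ideal.Quotient.mk_surjective (by
      rw [Ideal.mk_ker]; exact hIp Z)
  let F : TopologicalSpace.IrreducibleCloseds V → (PrimeSpectrum S)ᵒᵈ := fun Z =>
    OrderDual.toDual (PrimeSpectrum.comap (algebraMap S A)
      ⟨Ideal.map (Ideal.Quotient.mk I) (p Z), hq Z⟩)
  have hF : StrictMono F := by
    intro Z Z' h
    have := hq Z'
    have hlt : Ideal.map (Ideal.Quotient.mk I) (p Z') < Ideal.map (Ideal.Quotient.mk I) (p Z) := by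
      refine lt_of_le_not_ge (Ideal.map_mono (hanti _ _ h).le) fun hle => ?_
      have := Ideal.comap_mono (f := Ideal.Quotient.mk I) hle
      rw [hcomap, hcomap] at this
      exact (hanti _ _ h).not_ge this
    exact Ideal.IsIntegral.comap_lt_comap (R := S) hlt
  have := Order.krullDim_le_of_strictMono F hF
  rw [Order.krullDim_orderDual] at this
  exact this.trans hdim.le

end Zariski

section Generic

variable {ι κ σ : Type*}

/-- A set of tuples is separately open if all its one-variable slices are Zariski open. -/
def SepOpen [DecidableEq ι] (U : Set (ι → σ → ℂ)) : Prop :=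
  ∀ x i, IsOpen[zt σ] {u | Function.update x i u ∈ U}

lemma SepOpen.inter [DecidableEq ι] {U U' : Set (ι → σ → ℂ)} (h : SepOpen U) (h' : SepOpen U') :
    SepOpen (U ∩ U') := by
  let _ := zt σ
  exact fun x i => (h x i).inter (h' x i)

lemma sepOpen_of_forall_mem [DecidableEq ι] {S : Set (ι → σ → ℂ)}
    (h : ∀ x ∈ S, ∃ U ⊆ S, SepOpen U ∧ x ∈ U) : SepOpen S := by
  intro x i
  let _ := zt σ
  refine isOpen_iff_forall_mem_open.2 fun u hu => ?_
  obtain ⟨U, hUS, hU, hxU⟩ := h _ hu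
  exact ⟨_, fun v hv => hUS hv, hU x i, hxU⟩

lemma exists_mem_inter_of_sepOpen [DecidableEq ι] [Finite ι] {V : Set (σ → ℂ)}
    (hV : zIsIrreducible V)
    {U U' : Set (ι → σ → ℂ)} (hU : SepOpen U) (hU' : SepOpen U')
    (h : ∃ x ∈ U, ∀ i, x i ∈ V) (h' : ∃ x ∈ U', ∀ i, x i ∈ V) :
    ∃ x ∈ U ∩ U', ∀ i, x i ∈ V := by
  have _ := Fintype.ofFinite ι
  suffices H : ∀ s : Finset ι, ∃ x ∈ U, ∃ y ∈ U', (∀ i, x i ∈ V) ∧ (∀ i, y i ∈ V) ∧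
      ∀ i ∈ s, x i = y i by
    obtain ⟨x, hx, y, hy, hxV, -, hxy⟩ := H Finset.univ
    obtain rfl : x = y := funext fun i => hxy i (Finset.mem_univ i)
    exact ⟨x, ⟨hx, hy⟩, hxV⟩
  intro s
  induction s using Finset.induction_on with
  | empty =>
    obtain ⟨x, hx, hxV⟩ := h
    obtain ⟨y, hy, hyV⟩ := h'
    exact ⟨x, hx, y, hy, hxV, hyV, by simp⟩
  | insert i s _ ih =>
    obtain ⟨x, hx, y, hy, hxV, hyV, hxy⟩ := ih
    obtain ⟨u, huV, hux, huy⟩ := hV.2 _ _ (hU x i) (hU' y i)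
      ⟨x i, hxV i, by simpa using hx⟩ ⟨y i, hyV i, by simpa using hy⟩
    refine ⟨_, hux, _, huy, fun j => ?_, fun j => ?_, fun j hj => ?_⟩
    · rcases eq_or_ne j i with rfl | hji <;> simp [*]
    · rcases eq_or_ne j i with rfl | hji <;> simp [*]
    · rcases eq_or_ne j i with rfl | hji
      · simp
      · simp [hji, hxy j (Finset.mem_of_mem_insert_of_ne hj hji)]

/-- The filter of properties that hold for a generic tuple of points of an irreducible set. -/
def genericTuple (ι : Type*) [DecidableEq ι] [Finite ι] {V : Set (σ → ℂ)}
    (hV : zIsIrreducible V) : Filter (ι → σ → ℂ) where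
  sets := {S | ∃ U, SepOpen U ∧ (∃ x ∈ U, ∀ i, x i ∈ V) ∧ ∀ x ∈ U, (∀ i, x i ∈ V) → x ∈ S}
  univ_sets := by
    obtain ⟨v, hv⟩ := hV.1
    refine ⟨Set.univ, fun x i => ?_, ⟨fun _ => v, trivial, fun _ => hv⟩, fun _ _ _ => trivial⟩
    simp
  sets_of_superset := by
    rintro S S' ⟨U, hU, hne, hUS⟩ hSS'
    exact ⟨U, hU, hne, fun x hx hxV => hSS' (hUS x hx hxV)⟩
  inter_sets := by
    rintro S S' ⟨U, hU, hne, hUS⟩ ⟨U', hU', hne', hUS'⟩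
    exact ⟨U ∩ U', hU.inter hU', exists_mem_inter_of_sepOpen hV hU hU' hne hne',
      fun x hx hxV => ⟨hUS x hx.1 hxV, hUS' x hx.2 hxV⟩⟩

variable [DecidableEq ι] [Finite ι] [DecidableEq κ] [Finite κ] {V : Set (σ → ℂ)}
  (hV : zIsIrreducible V)

lemma eventually_genericTuple_iff {P : (ι → σ → ℂ) → Prop} :
    (∀ᶠ x in genericTuple ι hV, P x) ↔
      ∃ U, SepOpen U ∧ (∃ x ∈ U, ∀ i, x i ∈ V) ∧ ∀ x ∈ U, (∀ i, x i ∈ V) → P x :=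
  Iff.rfl

instance genericTuple_neBot : (genericTuple ι hV).NeBot := by
  refine Filter.neBot_iff.2 fun h => ?_
  have : ∅ ∈ genericTuple ι hV := h ▸ Filter.mem_bot
  obtain ⟨U, -, ⟨x, hx, hxV⟩, hU⟩ := this
  exact hU x hx hxV

lemma eventually_genericTuple_mem : ∀ᶠ x in genericTuple ι hV, ∀ i, x i ∈ V :=
  (eventually_genericTuple_iff hV).2 <| by
    obtain ⟨v, hv⟩ := hV.1
    refine ⟨Set.univ, fun x i => ?_, ⟨fun _ => v, trivial, fun _ => hv⟩, fun _ _ h => h⟩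
    simp

lemma eventually_genericTuple_of_sepOpen {U : Set (ι → σ → ℂ)} (hU : SepOpen U)
    (hne : ∃ x ∈ U, ∀ i, x i ∈ V) : ∀ᶠ x in genericTuple ι hV, x ∈ U :=
  (eventually_genericTuple_iff hV).2 ⟨U, hU, hne, fun _ h _ => h⟩

lemma exists_eventually_sumElim {P : (ι ⊕ κ → σ → ℂ) → Prop}
    (h : ∀ᶠ x in genericTuple (ι ⊕ κ) hV, P x) :
    ∃ c : κ → σ → ℂ, (∃ a, P (Sum.elim a c)) ∧
      ∀ᶠ a in genericTuple ι hV, P (Sum.elim a c) := by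
  obtain ⟨U, hU, ⟨x, hx, hxV⟩, hUP⟩ := (eventually_genericTuple_iff hV).1 h
  have hx' : Sum.elim (x ∘ Sum.inl) (x ∘ Sum.inr) = x := Sum.elim_comp_inl_inr x
  refine ⟨x ∘ Sum.inr, ⟨x ∘ Sum.inl, by rw [hx']; exact hUP x hx hxV⟩,
    (eventually_genericTuple_iff hV).2 ⟨{a | Sum.elim a (x ∘ Sum.inr) ∈ U}, fun a i => ?_,
      ⟨x ∘ Sum.inl, by simpa [hx'] using hx, fun i => hxV _⟩, fun a ha haV => hUP _ ha ?_⟩⟩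
  · have := hU (Sum.elim a (x ∘ Sum.inr)) (Sum.inl i)
    simp only [Sum.update_elim_inl] at this
    exact this
  · rintro (i | i)
    exacts [haV i, hxV _]

end Generic

section PolyMap

variable {ι σ : Type*}

/-- A map `ℂ^σ → ℂ^σ` with polynomial components. -/
def IsPolyMap (w : (σ → ℂ) → (σ → ℂ)) : Prop :=
  ∃ p : σ → MvPolynomial σ ℂ, ∀ x l, w x l = eval x (p l)

lemma isPolyMap_linearMap [Fintype σ] [DecidableEq σ] (f : (σ → ℂ) →ₗ[ℂ] (σ → ℂ)) :
    IsPolyMap f := by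
  refine ⟨fun l => ∑ j, C (f (fun k => if j = k then 1 else 0) l) * X j, fun x l => ?_⟩
  rw [LinearMap.pi_apply_eq_sum_univ f x]
  simp [mul_comm]

lemma IsPolyMap.eval_comp {w : (σ → ℂ) → (σ → ℂ)} (hw : IsPolyMap w) (f : MvPolynomial σ ℂ) :
    ∃ g : MvPolynomial σ ℂ, ∀ x, eval (w x) f = eval x g := by
  obtain ⟨p, hp⟩ := hw
  refine ⟨bind₁ p f, fun x => ?_⟩
  have : w x = fun l => eval x (p l) := funext (hp x)
  rw [this, ← aeval_eq_eval, ← aeval_eq_eval, aeval_bind₁]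

lemma IsPolyMap.comp {w w' : (σ → ℂ) → (σ → ℂ)} (hw : IsPolyMap w) (hw' : IsPolyMap w') :
    IsPolyMap (w ∘ w') := by
  obtain ⟨p, hp⟩ := hw
  choose q hq using fun l => hw'.eval_comp (p l)
  exact ⟨q, fun x l => by rw [Function.comp_apply, hp, hq]⟩

lemma IsPolyMap.isOpen_preimage {w : (σ → ℂ) → (σ → ℂ)} (hw : IsPolyMap w) {U : Set (σ → ℂ)}
    (hU : IsOpen[zt σ] U) : IsOpen[zt σ] (w ⁻¹' U) := by
  let _ := zt σ
  refine isOpen_iff_forall_mem_open.2 fun x hx => ?_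
  obtain ⟨f, hf, hfU⟩ := exists_eval_ne_zero_of_isOpen_zt hU hx
  obtain ⟨g, hg⟩ := hw.eval_comp f
  exact ⟨_, fun y hy => hfU _ (by rw [hg]; exact hy), isOpen_zt_ne_zero g,
    by simpa [← hg] using hf⟩

/-- Linear independence of the values of polynomial maps at the entries of a tuple is a separately
open condition. -/
lemma sepOpen_linearIndependent [DecidableEq ι] [Fintype σ] {κ : Type*} [Finite κ]
    (w : κ → (σ → ℂ) → (σ → ℂ)) (hw : ∀ k, IsPolyMap (w k)) (a : κ → ι) :
    SepOpen {x : ι → σ → ℂ | LinearIndependent ℂ fun k => w k (x (a k))} := by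
  classical
  have _ := Fintype.ofFinite κ
  refine sepOpen_of_forall_mem fun x₀ hx₀ => ?_
  obtain ⟨f, hf⟩ := LinearMap.exists_leftInverse_of_injective
    (Fintype.linearCombination ℂ fun k => w k (x₀ (a k))) (LinearMap.ker_eq_bot.2
      (hx₀.fintypeLinearCombination_injective))
  let M : (ι → σ → ℂ) → Matrix κ κ ℂ := fun x k => f (w k (x (a k)))
  refine ⟨{x | (M x).det ≠ 0}, fun x hx => ?_, fun x i => ?_, ?_⟩
  · exact LinearIndependent.of_comp f (Matrix.linearIndependent_rows_of_det_ne_zero hx)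
  · choose p hp using hw
    let q : κ → σ → MvPolynomial σ ℂ := fun k l =>
      if a k = i then p k l else C (w k (x (a k)) l)
    let Q : Matrix κ κ (MvPolynomial σ ℂ) := fun k k' => ∑ l, C (f (Pi.single l 1) k') * q k l
    have hQ : ∀ u, (M (Function.update x i u)).det = eval u Q.det := by
      intro u
      rw [RingHom.map_det]
      congr 1
      ext k k'
      have h1 : w k (Function.update x i u (a k)) = ∑ l, eval u (q k l) • Pi.single l (1 : ℂ) := by
        ext l
        rw [Finset.sum_apply]
        by_cases h : a k = i
        · simp [q, h, hp, Pi.single_apply]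
        · simp [q, h, Pi.single_apply]
      rw [RingHom.mapMatrix_apply, Matrix.map_apply]
      simp only [M, Q, h1, map_sum, map_smul, Finset.sum_apply, Pi.smul_apply, smul_eq_mul,
        map_mul, eval_C]
      exact Finset.sum_congr rfl fun l _ => mul_comm _ _
    simpa only [Set.mem_ofPred_eq, hQ] using isOpen_zt_ne_zero Q.det
  · have : M x₀ = 1 := by
      ext k k'
      have := LinearMap.congr_fun hf (Pi.single k 1)
      simp only [LinearMap.comp_apply, Fintype.linearCombination_apply_single, one_smul,
        LinearMap.id_apply] at this
      simp [M, this, Pi.single_apply, Matrix.one_apply, eq_comm]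
    simp [this]

end PolyMap

section GenericRank

variable {ι σ : Type*} {W : Set ((σ → ℂ) → (σ → ℂ))} {V : Set (σ → ℂ)}

/-- The span of the values at `x` of the vector fields in `W`. -/
def spanAt (W : Set ((σ → ℂ) → (σ → ℂ))) (x : σ → ℂ) : Submodule ℂ (σ → ℂ) :=
  Submodule.span ℂ ((fun w => w x) '' W)

/-- The sum of the spaces `spanAt W (x i)` over `i ∈ s`. -/
def spanOn (W : Set ((σ → ℂ) → (σ → ℂ))) (s : Finset ι) (x : ι → σ → ℂ) : Submodule ℂ (σ → ℂ) :=
  s.sup fun i => spanAt W (x i)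

lemma spanOn_mono {s t : Finset ι} (h : s ⊆ t) (x : ι → σ → ℂ) : spanOn W s x ≤ spanOn W t x :=
  Finset.sup_mono h

lemma spanOn_insert [DecidableEq ι] (i : ι) (s : Finset ι) (x : ι → σ → ℂ) :
    spanOn W (insert i s) x = spanAt W (x i) ⊔ spanOn W s x :=
  Finset.sup_insert

lemma spanOn_singleton (i : ι) (x : ι → σ → ℂ) : spanOn W {i} x = spanAt W (x i) :=
  Finset.sup_singleton

lemma spanOn_map {κ : Type*} (e : κ ↪ ι) (s : Finset κ) (x : ι → σ → ℂ) :
    spanOn W (s.map e) x = spanOn W s (x ∘ e) :=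
  Finset.sup_map s e _

lemma spanOn_eq_span (s : Finset ι) (x : ι → σ → ℂ) :
    spanOn W s x = Submodule.span ℂ {v | ∃ w ∈ W, ∃ i ∈ s, w (x i) = v} := by
  apply le_antisymm
  · refine Finset.sup_le fun i hi => Submodule.span_mono ?_
    rintro _ ⟨w, hw, rfl⟩
    exact ⟨w, hw, i, hi, rfl⟩
  · refine Submodule.span_le.2 ?_
    rintro _ ⟨w, hw, i, hi, rfl⟩
    exact (Finset.le_sup (f := fun i => spanAt W (x i)) hi)
      (Submodule.subset_span ⟨w, hw, rfl⟩)

variable [Fintype σ]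

/-- Lower semicontinuity of the rank. -/
lemma sepOpen_le_finrank_spanOn [DecidableEq ι] (hW : ∀ w ∈ W, IsPolyMap w) (s : Finset ι)
    (r : ℕ) : SepOpen {x : ι → σ → ℂ | r ≤ Module.finrank ℂ (spanOn W s x)} := by
  refine sepOpen_of_forall_mem fun x hx => ?_
  obtain ⟨b, hb, hspan, hli⟩ :=
    exists_linearIndependent ℂ {v | ∃ w ∈ W, ∃ i ∈ s, w (x i) = v}
  have _ : Fintype b := hli.setFinite.fintype
  choose w hw a ha hwa using fun k : b => hb k.2
  refine ⟨_, fun y hy => ?_, sepOpen_linearIndependent w (fun k => hW _ (hw k)) a, ?_⟩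
  · have hmem : ∀ k, w k (y (a k)) ∈ spanOn W s y := fun k => by
      rw [spanOn_eq_span]
      exact Submodule.subset_span ⟨_, hw k, _, ha k, rfl⟩
    have h1 : LinearIndependent ℂ fun k => (⟨w k (y (a k)), hmem k⟩ : spanOn W s y) :=
      LinearIndependent.of_comp (spanOn W s y).subtype hy
    refine le_trans ?_ h1.fintype_card_le_finrank
    have hx' : r ≤ Module.finrank ℂ (spanOn W s x) := hx
    rw [spanOn_eq_span, ← hspan, finrank_span_set_eq_card hli, Set.toFinset_card] at hx'
    exact hx'
  · simpa [hwa] using hli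

/-- The largest dimension of a sum of `j` spaces `spanAt W x`, `x ∈ V`. -/
def genericRank (W : Set ((σ → ℂ) → (σ → ℂ))) (V : Set (σ → ℂ)) (j : ℕ) : ℕ :=
  sSup {r | ∃ x : Fin j → σ → ℂ, (∀ i, x i ∈ V) ∧
    r = Module.finrank ℂ (spanOn W Finset.univ x)}

lemma genericRank_bddAbove (j : ℕ) : BddAbove {r | ∃ x : Fin j → σ → ℂ, (∀ i, x i ∈ V) ∧
    r = Module.finrank ℂ (spanOn W Finset.univ x)} := by
  refine ⟨Module.finrank ℂ (σ → ℂ), ?_⟩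
  rintro _ ⟨x, -, rfl⟩
  exact Submodule.finrank_le _

lemma finrank_spanOn_le_genericRank (s : Finset ι) (x : ι → σ → ℂ) (hx : ∀ i, x i ∈ V) :
    Module.finrank ℂ (spanOn W s x) ≤ genericRank W V s.card := by
  let e : Fin s.card ↪ ι := s.equivFin.symm.toEmbedding.trans (Function.Embedding.subtype _)
  refine le_csSup (genericRank_bddAbove _) ⟨x ∘ e, fun i => hx _, ?_⟩
  have hs : Finset.univ.map e = s := by
    ext i
    simp only [Finset.mem_map, Finset.mem_univ, true_and, e]
    exact ⟨by rintro ⟨k, rfl⟩; simp, fun hi => ⟨s.equivFin ⟨i, hi⟩, by simp⟩⟩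
  rw [← spanOn_map, hs]

lemma eventually_finrank_spanOn_eq [DecidableEq ι] [Finite ι] (hW : ∀ w ∈ W, IsPolyMap w)
    (hV : zIsIrreducible V) :
    ∀ᶠ x in genericTuple ι hV, ∀ s : Finset ι,
      Module.finrank ℂ (spanOn W s x) = genericRank W V s.card := by
  have _ := Fintype.ofFinite ι
  refine Filter.eventually_all.2 fun s => ?_
  obtain ⟨v, hv⟩ := hV.1
  have hne : ∃ x : ι → σ → ℂ, (∀ i, x i ∈ V) ∧
      genericRank W V s.card ≤ Module.finrank ℂ (spanOn W s x) := by
    have hmem : genericRank W V s.card ∈ {r | ∃ x : Fin s.card → σ → ℂ, (∀ i, x i ∈ V) ∧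
        r = Module.finrank ℂ (spanOn W Finset.univ x)} :=
      Nat.sSup_mem ⟨_, fun _ => v, fun _ => hv, rfl⟩ (genericRank_bddAbove _)
    obtain ⟨y, hy, hr⟩ := hmem
    let x : ι → σ → ℂ := fun i => if h : i ∈ s then y (s.equivFin ⟨i, h⟩) else v
    let e : Fin s.card ↪ ι := s.equivFin.symm.toEmbedding.trans (Function.Embedding.subtype _)
    have hxe : x ∘ e = y := by
      ext i : 1
      simp [x, e]
    refine ⟨x, fun i => ?_, ?_⟩
    · by_cases h : i ∈ s
      · simp [x, h, hy]
      · simp [x, h, hv]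
    · have hle : spanOn W Finset.univ y ≤ spanOn W s x := by
        rw [← hxe, ← spanOn_map]
        refine spanOn_mono (fun i hi => ?_) x
        obtain ⟨k, -, rfl⟩ := Finset.mem_map.1 hi
        simp [e]
      exact hr.trans_le (Submodule.finrank_mono hle)
  obtain ⟨x, hxV, hx⟩ := hne
  filter_upwards [eventually_genericTuple_mem hV, eventually_genericTuple_of_sepOpen hV
    (sepOpen_le_finrank_spanOn hW s (genericRank W V s.card)) ⟨x, hx, hxV⟩] with y hyV hy
  exact le_antisymm (finrank_spanOn_le_genericRank s y hyV) hy

lemma genericRank_le_succ (hW : ∀ w ∈ W, IsPolyMap w) (hV : zIsIrreducible V) (j : ℕ) :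
    genericRank W V j ≤ genericRank W V (j + 1) := by
  obtain ⟨x, hx⟩ := (eventually_finrank_spanOn_eq (ι := Fin (j + 1)) hW hV).exists
  have h1 := hx (Finset.univ.erase 0)
  have h2 := hx Finset.univ
  simp only [Finset.mem_univ, Finset.card_erase_of_mem, Finset.card_univ, Fintype.card_fin,
    Nat.add_sub_cancel] at h1 h2
  rw [← h1, ← h2]
  exact Submodule.finrank_mono (spanOn_mono (Finset.subset_univ _) x)

lemma genericRank_concave (hW : ∀ w ∈ W, IsPolyMap w) (hV : zIsIrreducible V) (j : ℕ) :
    genericRank W V (j + 2) + genericRank W V j ≤ 2 * genericRank W V (j + 1) := by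
  obtain ⟨x, hx⟩ := (eventually_finrank_spanOn_eq (ι := Option (Option (Fin j))) hW hV).exists
  let s : Finset (Option (Option (Fin j))) := Finset.univ.map
    (Function.Embedding.some.trans Function.Embedding.some)
  have hs : s.card = j := by simp [s]
  have h1 : none ∉ s := by simp [s]
  have h2 : some none ∉ s := by simp [s]
  have h3 : none ∉ insert (some none) s := by simp [s]
  have e0 := hx s
  have e1 := hx (insert none s)
  have e2 := hx (insert (some none) s)
  have e3 := hx (insert none (insert (some none) s))
  rw [Finset.card_insert_of_notMem h3, Finset.card_insert_of_notMem h2] at e3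
  rw [Finset.card_insert_of_notMem h1] at e1
  rw [Finset.card_insert_of_notMem h2] at e2
  rw [hs] at e0 e1 e2 e3
  have hsup : spanOn W (insert none (insert (some none) s)) x =
      spanOn W (insert none s) x ⊔ spanOn W (insert (some none) s) x := by
    simp only [spanOn_insert]
    rw [sup_sup_sup_comm, sup_idem, sup_assoc]
  have hle : spanOn W s x ≤
      spanOn W (insert none s) x ⊓ spanOn W (insert (some none) s) x :=
    le_inf (spanOn_mono (Finset.subset_insert _ _) x) (spanOn_mono (Finset.subset_insert _ _) x)
  have h4 := Submodule.finrank_mono hle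
  have h5 := Submodule.finrank_sup_add_finrank_inf_eq (spanOn W (insert none s) x)
    (spanOn W (insert (some none) s) x)
  rw [← hsup] at h5
  lia

/-- If adding a point to `s` or to `insert z s` raises the rank by the same amount, the
intersection of a further space with the span does not depend on the choice of points. -/
lemma inf_spanOn_eq_of_card_eq [DecidableEq ι] {x : ι → σ → ℂ} {j : ℕ}
    (hx : ∀ s : Finset ι, Module.finrank ℂ (spanOn W s x) = genericRank W V s.card)
    (hj : genericRank W V (j + 2) + genericRank W V j = 2 * genericRank W V (j + 1)) (y : ι) :
    ∀ s t : Finset ι, s.card = j → t.card = j → y ∉ s → y ∉ t →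
      spanAt W (x y) ⊓ spanOn W s x = spanAt W (x y) ⊓ spanOn W t x := by
  have hfin : ∀ s : Finset ι, y ∉ s →
      genericRank W V (s.card + 1) + Module.finrank ℂ ↥(spanAt W (x y) ⊓ spanOn W s x) =
        Module.finrank ℂ (spanAt W (x y)) + genericRank W V s.card := by
    intro s hys
    rw [← Finset.card_insert_of_notMem hys, ← hx, ← hx, spanOn_insert,
      Submodule.finrank_sup_add_finrank_inf_eq]
  have hadd : ∀ (s : Finset ι) (z : ι), s.card = j → y ∉ s → z ∉ s → z ≠ y →
      spanAt W (x y) ⊓ spanOn W s x = spanAt W (x y) ⊓ spanOn W (insert z s) x := by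
    intro s z hs hys hzs hzy
    refine Submodule.eq_of_le_of_finrank_eq
      (inf_le_inf_left _ (spanOn_mono (Finset.subset_insert _ _) x)) ?_
    have h1 := hfin s hys
    have h2 := hfin (insert z s) (by simp [hys, hzy.symm])
    rw [Finset.card_insert_of_notMem hzs] at h2
    rw [hs] at h1 h2
    lia
  intro s t hs ht hys hyt
  induction hn : (s \ t).card generalizing s with
  | zero =>
    have hst : s ⊆ t := Finset.sdiff_eq_empty_iff_subset.1 (Finset.card_eq_zero.1 hn)
    rw [Finset.eq_of_subset_of_card_le hst (by lia)]
  | succ n ih =>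
    obtain ⟨a, ha⟩ := Finset.card_pos.1 (show 0 < (s \ t).card by lia)
    obtain ⟨b, hb⟩ := Finset.card_pos.1 (show 0 < (t \ s).card by
      rw [Finset.card_sdiff_comm (ht.trans hs.symm)]; lia)
    rw [Finset.mem_sdiff] at ha hb
    have hay : a ≠ y := fun h => hys (h ▸ ha.1)
    have hby : b ≠ y := fun h => hyt (h ▸ hb.1)
    have hab : a ≠ b := fun h => hb.2 (h ▸ ha.1)
    have hbe : b ∉ s.erase a := fun h => hb.2 (Finset.mem_of_mem_erase h)
    have hcard : (insert b (s.erase a)).card = j := by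
      rw [Finset.card_insert_of_notMem hbe, Finset.card_erase_of_mem ha.1]
      have := Finset.card_pos.2 ⟨a, ha.1⟩
      lia
    have hy' : y ∉ insert b (s.erase a) := by simp [hys, hby.symm]
    have hswap : insert a (insert b (s.erase a)) = insert b s := by
      rw [Finset.insert_comm, Finset.insert_erase ha.1]
    rw [hadd s b hs hys hb.2 hby, ← hswap,
      ← hadd _ a hcard hy' (by simp [hab]) hay]
    refine ih _ hcard hy' ?_
    have : insert b (s.erase a) \ t = (s \ t).erase a := by
      rw [Finset.insert_sdiff_of_mem _ hb.1, Finset.erase_sdiff_comm]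
    rw [this, Finset.card_erase_of_mem (Finset.mem_sdiff.2 ha), hn, Nat.add_sub_cancel]

/-- If the increments of the generic rank stall at `j`, below their initial value, then some
nonzero vector lies in the span at a generic `j`-tuple. -/
lemma exists_ne_zero_eventually_mem_spanOn (hW : ∀ w ∈ W, IsPolyMap w) (hV : zIsIrreducible V)
    {j : ℕ}
    (hj : genericRank W V (j + 2) + genericRank W V j = 2 * genericRank W V (j + 1))
    (hlt : genericRank W V (j + 1) < genericRank W V j + genericRank W V 1) :
    ∃ v ≠ 0, ∀ᶠ x in genericTuple (Fin j) hV, v ∈ spanOn W Finset.univ x := by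
  obtain ⟨c, ⟨a, ha⟩, hc⟩ := exists_eventually_sumElim (ι := Fin j) (κ := Option (Fin j)) hV
    (eventually_finrank_spanOn_eq hW hV)
  let y : Fin j ⊕ Option (Fin j) := Sum.inr none
  let s : Finset (Fin j ⊕ Option (Fin j)) := Finset.univ.map Function.Embedding.inl
  let t : Finset (Fin j ⊕ Option (Fin j)) := Finset.univ.map
    (Function.Embedding.some.trans Function.Embedding.inr)
  have hs : s.card = j := by simp [s]
  have ht : t.card = j := by simp [t]
  have hys : y ∉ s := by simp [s, y]
  have hyt : y ∉ t := by simp [t, y]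
  have hSt : ∀ a', spanOn W t (Sum.elim a' c) = spanOn W t (Sum.elim a c) := by
    intro a'
    simp only [t, spanOn_map]
    rfl
  have hne : spanAt W (Sum.elim a c y) ⊓ spanOn W t (Sum.elim a c) ≠ ⊥ := by
    intro hbot
    have h1 := Submodule.finrank_sup_add_finrank_inf_eq (spanAt W (Sum.elim a c y))
      (spanOn W t (Sum.elim a c))
    rw [hbot, finrank_bot, ← spanOn_insert, ha, ← spanOn_singleton y, ha, ha,
      Finset.card_insert_of_notMem hyt, ht, Finset.card_singleton] at h1
    lia
  obtain ⟨v, hv, hv0⟩ := Submodule.exists_mem_ne_zero_of_ne_bot hne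
  refine ⟨v, hv0, hc.mono fun a' ha' => ?_⟩
  have h2 : v ∈ spanAt W (Sum.elim a' c y) ⊓ spanOn W t (Sum.elim a' c) := by
    rw [hSt]
    exact hv
  rw [← inf_spanOn_eq_of_card_eq ha' hj y s t hs ht hys hyt] at h2
  have h3 := h2.2
  simp only [s, spanOn_map] at h3
  exact h3

end GenericRank

section Tangent

variable {σ : Type*} [Fintype σ] {V : Set (σ → ℂ)}

lemma hasDerivAt_eval_add_smul (f : MvPolynomial σ ℂ) (x v : σ → ℂ) :
    HasDerivAt (fun t : ℂ => eval (x + t • v) f) (∑ l, v l * eval x (pderiv l f)) 0 := by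
  classical
  induction f using MvPolynomial.induction_on with
  | C a => simpa using hasDerivAt_const (0 : ℂ) a
  | add p q hp hq => simpa [mul_add, Finset.sum_add_distrib] using hp.fun_add hq
  | mul_X p n hp =>
    have h1 : HasDerivAt (fun t : ℂ => x n + t * v n) (v n) 0 := by
      simpa using ((hasDerivAt_id (0 : ℂ)).mul_const (v n)).const_add (x n)
    have h2 := hp.fun_mul h1
    have h3 : (∑ l, v l * eval x (pderiv l (p * X n))) =
        (∑ l, v l * eval x (pderiv l p)) * (x n + 0 * v n) +
          eval (x + (0 : ℂ) • v) p * v n := by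
      simp only [pderiv_mul, map_add, map_mul, eval_X, pderiv_X, mul_add, Finset.sum_add_distrib,
        zero_mul, zero_smul, add_zero, Finset.sum_mul]
      congr 1
      · exact Finset.sum_congr rfl fun l _ => by ring
      · rw [Finset.sum_eq_single n (fun l _ hl => by simp [Pi.single_eq_of_ne' hl]) (by simp)]
        simp [mul_comm]
    rw [h3]
    simpa using h2

lemma sum_mul_eval_pderiv_congr {f g : MvPolynomial σ ℂ} {x y v w : σ → ℂ}
    (h : ∀ t : ℂ, eval (y + t • w) f = eval (x + t • v) g) :
    ∑ l, w l * eval y (pderiv l f) = ∑ l, v l * eval x (pderiv l g) := by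
  have h1 := hasDerivAt_eval_add_smul f y w
  simp only [h] at h1
  exact h1.unique (hasDerivAt_eval_add_smul g x v)

/-- The Zariski tangent space of `V` at `x`. -/
def tangentSpace (V : Set (σ → ℂ)) (x : σ → ℂ) : Submodule ℂ (σ → ℂ) where
  carrier := {v | ∀ f ∈ vanishingIdeal ℂ V, ∑ l, v l * eval x (pderiv l f) = 0}
  zero_mem' := by simp
  add_mem' := by
    intro a b ha hb f hf
    simp [add_mul, Finset.sum_add_distrib, ha f hf, hb f hf]
  smul_mem' := by
    intro c a ha f hf
    simp [mul_assoc, ← Finset.mul_sum, ha f hf]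

/-- The polynomial vector fields tangent to `V`. -/
def tangentFields (V : Set (σ → ℂ)) : Set ((σ → ℂ) → (σ → ℂ)) :=
  {w | IsPolyMap w ∧ ∀ x ∈ V, w x ∈ tangentSpace V x}

lemma spanAt_tangentFields_le {x : σ → ℂ} (hx : x ∈ V) :
    spanAt (tangentFields V) x ≤ tangentSpace V x := by
  refine Submodule.span_le.2 ?_
  rintro _ ⟨w, hw, rfl⟩
  exact hw.2 x hx

lemma map_mem_tangentSpace {A : (σ → ℂ) →ₗ[ℂ] (σ → ℂ)} (hA : ∀ x ∈ V, A x ∈ V) {x v : σ → ℂ}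
    (hv : v ∈ tangentSpace V x) : A v ∈ tangentSpace V (A x) := by
  classical
  intro f hf
  obtain ⟨g, hg⟩ := (isPolyMap_linearMap A).eval_comp f
  rw [sum_mul_eval_pderiv_congr (x := x) (v := v) (g := g) fun t => by
    rw [← hg, map_add, map_smul]]
  refine hv g (mem_vanishingIdeal_iff_eval.2 fun y hy => ?_)
  rw [← hg]
  exact mem_vanishingIdeal_iff_eval.1 hf _ (hA y hy)

lemma spanOn_tangentFields_le_comap {ι : Type*} (A : (σ → ℂ) ≃ₗ[ℂ] (σ → ℂ))
    (hA : ∀ x ∈ V, A x ∈ V) (hA' : ∀ x ∈ V, A.symm x ∈ V) (s : Finset ι) (x : ι → σ → ℂ) :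
    spanOn (tangentFields V) s x ≤
      (spanOn (tangentFields V) s fun i => A (x i)).comap (A : (σ → ℂ) →ₗ[ℂ] (σ → ℂ)) := by
  classical
  rw [spanOn_eq_span, spanOn_eq_span, Submodule.span_le]
  rintro _ ⟨w, ⟨hwp, hwt⟩, i, hi, rfl⟩
  refine Submodule.subset_span ⟨A ∘ w ∘ A.symm, ⟨?_, fun y hy => ?_⟩, i, hi, by simp⟩
  · exact (isPolyMap_linearMap (A : (σ → ℂ) →ₗ[ℂ] (σ → ℂ))).comp
      (hwp.comp (isPolyMap_linearMap (A.symm : (σ → ℂ) →ₗ[ℂ] (σ → ℂ))))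
  · have h := map_mem_tangentSpace (A := (A : (σ → ℂ) →ₗ[ℂ] (σ → ℂ))) hA (hwt _ (hA' y hy))
    simpa using h

lemma eventually_genericTuple_comp {ι : Type*} [DecidableEq ι] [Finite ι]
    (hV : zIsIrreducible V) (A : (σ → ℂ) ≃ₗ[ℂ] (σ → ℂ)) (hA : ∀ x ∈ V, A x ∈ V)
    (hA' : ∀ x ∈ V, A.symm x ∈ V) {P : (ι → σ → ℂ) → Prop}
    (h : ∀ᶠ x in genericTuple ι hV, P x) :
    ∀ᶠ x in genericTuple ι hV, P fun i => A.symm (x i) := by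
  classical
  obtain ⟨U, hU, ⟨x, hx, hxV⟩, hUP⟩ := (eventually_genericTuple_iff hV).1 h
  refine (eventually_genericTuple_iff hV).2 ⟨{x | (fun i => A.symm (x i)) ∈ U}, fun y i => ?_,
    ⟨fun i => A (x i), by simpa using hx, fun i => hA _ (hxV i)⟩,
    fun y hy hyV => hUP _ hy fun i => hA' _ (hyV i)⟩
  convert (isPolyMap_linearMap (A.symm : (σ → ℂ) →ₗ[ℂ] (σ → ℂ))).isOpen_preimage
    (hU (fun i => A.symm (y i)) i) using 1
  ext u
  have : (fun k => A.symm (Function.update y i u k)) =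
      Function.update (fun k => A.symm (y k)) i (A.symm u) := by
    ext k : 1
    exact Function.apply_update (fun _ => A.symm) y i u k
  simp [this]

lemma zDim_le_genericRank_one (hclosed : zIsClosed V) (hV : zIsIrreducible V) :
    zDim V ≤ genericRank (tangentFields V) V 1 := by
  classical
  have hI := vanishingIdeal_isPrime hV
  obtain ⟨s, g, hinj, hint⟩ := exists_integral_inj_algHom_of_fg ℂ
    (MvPolynomial σ ℂ ⧸ vanishingIdeal ℂ V)
  refine (zDim_le_of_isIntegral hclosed g hint).trans ?_
  obtain ⟨w, q, h, hh, hw, hq⟩ := exists_tangent_fields (vanishingIdeal ℂ V) g hinj hint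
  obtain ⟨x, hxV, hx⟩ : ∃ x ∈ V, eval x h ≠ 0 := by
    by_contra! hcon
    exact hh (mem_vanishingIdeal_iff_eval.2 hcon)
  have hmem : ∀ i, (fun l => eval x (w i l)) ∈ spanAt (tangentFields V) x := fun i =>
    Submodule.subset_span ⟨fun y l => eval y (w i l), ⟨⟨w i, fun _ _ => rfl⟩,
      fun y hy f hf => by
        simpa using mem_vanishingIdeal_iff_eval.1 (hw i f hf) y hy⟩, rfl⟩
  have hpair : ∀ i j, ∑ l, eval x (w i l) * eval x (pderiv l (q j)) =
      if i = j then eval x h else 0 := by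
    intro i j
    have := mem_vanishingIdeal_iff_eval.1 (hq i j) x hxV
    split_ifs at this ⊢ <;> simpa [sub_eq_zero] using this
  have hli : LinearIndependent ℂ
      fun i => (⟨fun l => eval x (w i l), hmem i⟩ : spanAt (tangentFields V) x) := by
    refine LinearIndependent.of_comp (spanAt (tangentFields V) x).subtype ?_
    refine Fintype.linearIndependent_iff.2 fun c hc j => ?_
    have h1 : ∑ l, (∑ i, c i * eval x (w i l)) * eval x (pderiv l (q j)) = c j * eval x h := by
      simp only [Finset.sum_mul, mul_assoc]
      rw [Finset.sum_comm]
      simp [← Finset.mul_sum, hpair]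
    have h2 : ∀ l, ∑ i, c i * eval x (w i l) = 0 := fun l => by
      simpa using congrFun hc l
    simp only [h2, zero_mul, Finset.sum_const_zero] at h1
    exact (mul_eq_zero.1 h1.symm).resolve_right hx
  have h3 := finrank_spanOn_le_genericRank (W := tangentFields V) (V := V)
    ({0} : Finset (Fin 1)) (fun _ => x) fun _ => hxV
  rw [spanOn_singleton, Finset.card_singleton] at h3
  have h4 := hli.fintype_card_le_finrank.trans h3
  rw [Fintype.card_fin] at h4
  exact_mod_cast h4

/-- If the tangent spaces at a generic `m`-tuple span the ambient space, the sums of `m` points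
are dense. -/
lemma secant_eq_univ_of_eventually_spanOn_eq_top (hV : zIsIrreducible V) {m : ℕ}
    (h : ∀ᶠ x in genericTuple (Fin m) hV, spanOn (tangentFields V) Finset.univ x = ⊤) :
    secant m V = Set.univ := by
  classical
  let J : Set (MvPolynomial σ ℂ) :=
    {f | ∀ x : Fin m → σ → ℂ, (∀ i, x i ∈ V) → eval (∑ i, x i) f = 0}
  have htan : ∀ f ∈ J, ∀ x : Fin m → σ → ℂ, (∀ i, x i ∈ V) → ∀ i,
      ∀ v ∈ tangentSpace V (x i), ∑ l, v l * eval (∑ i, x i) (pderiv l f) = 0 := by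
    intro f hf x hx i v hv
    have hpoly : IsPolyMap fun u : σ → ℂ => u + ∑ k ∈ Finset.univ.erase i, x k :=
      ⟨fun l => X l + C ((∑ k ∈ Finset.univ.erase i, x k) l), fun u l => by simp⟩
    obtain ⟨g, hg⟩ := hpoly.eval_comp f
    rw [sum_mul_eval_pderiv_congr (x := x i) (v := v) (g := g) fun t => by
      rw [← hg, ← Finset.add_sum_erase _ _ (Finset.mem_univ i), add_right_comm]]
    refine hv g (mem_vanishingIdeal_iff_eval.2 fun u hu => ?_)
    rw [← hg]
    have h1 := hf (Function.update x i u) fun k => by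
      rcases eq_or_ne k i with rfl | hk
      · simpa using hu
      · simpa [hk] using hx k
    rw [← Finset.add_sum_erase _ _ (Finset.mem_univ i), Function.update_self] at h1
    rwa [Finset.sum_congr rfl fun k hk =>
      Function.update_of_ne (Finset.ne_of_mem_erase hk) u x] at h1
  have hJ : ∀ f ∈ J, ∀ l, pderiv l f ∈ J := by
    intro f hf l x hx
    by_contra hne
    have hsep : SepOpen {x : Fin m → σ → ℂ | eval (∑ i, x i) (pderiv l f) ≠ 0} := by
      intro y i
      have hpoly : IsPolyMap fun u : σ → ℂ => u + ∑ k ∈ Finset.univ.erase i, y k :=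
        ⟨fun l => X l + C ((∑ k ∈ Finset.univ.erase i, y k) l), fun u l => by simp⟩
      convert hpoly.isOpen_preimage (isOpen_zt_ne_zero (pderiv l f)) using 1
      ext u
      simp only [Set.mem_ofPred_eq, Set.mem_preimage]
      rw [← Finset.add_sum_erase _ _ (Finset.mem_univ i), Function.update_self,
        Finset.sum_congr rfl fun k hk => Function.update_of_ne (Finset.ne_of_mem_erase hk) u y]
    obtain ⟨y, hy1, hy2, hyV⟩ := (h.and ((eventually_genericTuple_of_sepOpen hV hsep
      ⟨x, hne, hx⟩).and (eventually_genericTuple_mem hV))).exists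
    let φ : (σ → ℂ) →ₗ[ℂ] ℂ := ∑ l, eval (∑ i, y i) (pderiv l f) • LinearMap.proj l
    have hφ : ∀ v, φ v = ∑ l, v l * eval (∑ i, y i) (pderiv l f) := fun v => by
      simp [φ, mul_comm]
    have hker : spanOn (tangentFields V) Finset.univ y ≤ LinearMap.ker φ := by
      refine Finset.sup_le fun i _ => (spanAt_tangentFields_le (hyV i)).trans fun v hv => ?_
      rw [LinearMap.mem_ker, hφ]
      exact htan f hf y hyV i v hv
    rw [hy1] at hker
    have h1 := hker (Submodule.mem_top (x := Pi.single l 1))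
    rw [LinearMap.mem_ker, hφ, Finset.sum_eq_single l
      (fun k _ hk => by simp [Pi.single_eq_of_ne hk]) (by simp)] at h1
    exact hy2 (by simpa using h1)
  obtain ⟨v, hv⟩ := hV.1
  by_contra hne
  obtain ⟨p, hp⟩ := (Set.ne_univ_iff_exists_notMem _).1 hne
  obtain ⟨f, hf, hfp⟩ := exists_mem_vanishingIdeal_of_notMem
    (@isClosed_closure _ (zt σ) _) hp
  have hfJ : f ∈ J := fun x hx =>
    mem_vanishingIdeal_iff_eval.1 hf _ (@subset_closure _ (zt σ) _ _ ⟨x, hx, rfl⟩)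
  refine hfp ?_
  rw [eq_zero_of_pderiv_stable J hJ (fun c hc => ?_) hfJ, map_zero]
  simpa using hc (fun _ => v) fun _ => hv

end Tangent

/-- A concave sequence of natural numbers whose increments drop strictly as soon as they
are below `N`, and do not vanish up to `m`, grows at least linearly. -/
lemma mul_sub_le_of_increments {R : ℕ → ℕ} {N m : ℕ} (hN : N ≤ m)
    (hmono : ∀ j, R j ≤ R (j + 1)) (hpos : ∀ j ≤ m, R j < R (j + 1))
    (hstep : ∀ j ≤ m, R (j + 2) + R j < 2 * R (j + 1) ∨
      R j + N ≤ R (j + 1)) (hconc : ∀ j, R (j + 2) + R j ≤ 2 * R (j + 1)) :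
    N * (m - N) ≤ R m := by
  have hb : ∀ i, ∀ j, j + i = m → R j + min N (i + 1) ≤ R (j + 1) := by
    intro i
    induction i with
    | zero =>
      intro j hj
      have := hpos j (by lia)
      lia
    | succ i ih =>
      intro j hj
      have h1 := ih (j + 1) (by lia)
      have h2 := hstep j (by lia)
      have h3 := hconc j
      rw [show j + 1 + 1 = j + 2 by ring] at h1
      lia
  have hlin : ∀ j, j + N ≤ m → N * j ≤ R j := by
    intro j
    induction j with
    | zero => simp
    | succ j ih =>
      intro hj
      have h1 := ih (by lia)
      have h2 := hb (m - j) j (by lia)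
      rw [mul_add, mul_one]
      lia
  exact (hlin (m - N) (by lia)).trans (monotone_nat_of_le_succ hmono (Nat.sub_le m N))

/-- If the increments of the generic rank of the tangent spaces stall below their initial value,
the generic vectors form a nonzero submodule, so the tangent spaces span. -/
lemma eventually_spanOn_eq_top_of_stall {D : ℕ} {G : Type*} [Group G]
    {ρ : G →* ((Fin D → ℂ) ≃ₗ[ℂ] (Fin D → ℂ))} (hmod : IsIrreducibleGModule ρ)
    {V : Set (Fin D → ℂ)} (hirr : zIsIrreducible V) (hinv : ∀ (g : G), ∀ x ∈ V, ρ g x ∈ V)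
    {j : ℕ}
    (hj : genericRank (tangentFields V) V (j + 2) + genericRank (tangentFields V) V j =
      2 * genericRank (tangentFields V) V (j + 1))
    (hlt : genericRank (tangentFields V) V (j + 1) <
      genericRank (tangentFields V) V j + genericRank (tangentFields V) V 1) :
    ∀ᶠ x in genericTuple (Fin j) hirr, spanOn (tangentFields V) Finset.univ x = ⊤ := by
  obtain ⟨v, hv0, hv⟩ := exists_ne_zero_eventually_mem_spanOn (fun w hw => hw.1) hirr hj hlt
  let L : Submodule ℂ (Fin D → ℂ) :=
    { carrier := {v | ∀ᶠ x in genericTuple (Fin j) hirr,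
        v ∈ spanOn (tangentFields V) Finset.univ x}
      zero_mem' := by simp
      add_mem' := fun ha hb => by
        rw [Set.mem_ofPred_eq] at *
        filter_upwards [ha, hb] with x h1 h2 using add_mem h1 h2
      smul_mem' := fun c _ ha => by
        rw [Set.mem_ofPred_eq] at *
        filter_upwards [ha] with x h1 using Submodule.smul_mem _ c h1 }
  have hL : ∀ g : G, ∀ u ∈ L, ρ g u ∈ L := by
    intro g u hu
    have hsymm : ∀ x ∈ V, (ρ g).symm x ∈ V := fun x hx => by
      have := hinv g⁻¹ x hx
      rwa [map_inv] at this
    filter_upwards [eventually_genericTuple_comp hirr (ρ g) (hinv g) hsymm hu] with x hx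
    simpa using spanOn_tangentFields_le_comap (ρ g) (hinv g) hsymm _ _ hx
  rcases hmod.2 L hL with hbot | htop
  · have : v ∈ L := hv
    rw [hbot, Submodule.mem_bot] at this
    exact absurd this hv0
  · have hall : ∀ l : Fin D, ∀ᶠ x in genericTuple (Fin j) hirr,
        (Pi.basisFun ℂ (Fin D)) l ∈ spanOn (tangentFields V) Finset.univ x := fun l =>
      htop.ge (Submodule.mem_top (x := (Pi.basisFun ℂ (Fin D)) l))
    filter_upwards [Filter.eventually_all.2 hall] with x hx
    rw [eq_top_iff, ← (Pi.basisFun ℂ (Fin D)).span_eq, Submodule.span_le]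
    rintro _ ⟨l, rfl⟩
    exact hx l

theorem stmt_6 {D : ℕ} {G : Type*} [Group G]
    (ρ : G →* ((Fin D → ℂ) ≃ₗ[ℂ] (Fin D → ℂ)))
    (hmod : IsIrreducibleGModule ρ)
    (V : Set (Fin D → ℂ))
    (hclosed : zIsClosed V) (hirr : zIsIrreducible V)
    (hcone : ∀ (c : ℂ), ∀ x ∈ V, c • x ∈ V)
    (hinv : ∀ (g : G), ∀ x ∈ V, ρ g x ∈ V)
    (hV0 : V ≠ {0})
    (N : ℕ) (hdim : zDim V = (N : WithBot ℕ∞))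
    (m : ℕ) (hm : 1 ≤ m) (hbound : D + N ^ 2 ≤ N * m) :
    secant m V = Set.univ := by
  have hW : ∀ w ∈ tangentFields V, IsPolyMap w := fun w hw => hw.1
  set R := genericRank (tangentFields V) V
  have hrank : ∀ j, ∀ᶠ x in genericTuple (Fin j) hirr,
      Module.finrank ℂ (spanOn (tangentFields V) Finset.univ x) = R j := fun j => by
    filter_upwards [eventually_finrank_spanOn_eq (ι := Fin j) hW hirr] with x hx
    simpa using hx Finset.univ
  have hNR : N ≤ R 1 := by
    have := zDim_le_genericRank_one hclosed hirr
    rw [hdim] at this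
    exact_mod_cast this
  have hD : 1 ≤ D := hmod.1
  have hNpos : 0 < N := Nat.pos_of_ne_zero fun h => by
    simp only [h] at hbound
    lia
  have hNm : N ≤ m := Nat.le_of_mul_le_mul_left (by rw [← sq]; lia) hNpos
  refine secant_eq_univ_of_eventually_spanOn_eq_top hirr ?_
  suffices hDm : D ≤ R m by
    filter_upwards [hrank m] with x hx
    refine Submodule.eq_top_of_finrank_eq (le_antisymm (Submodule.finrank_le _) ?_)
    rw [hx, Module.finrank_fin_fun]
    exact hDm
  by_contra! hlt
  have hmono := genericRank_le_succ hW hirr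
  have hconc := genericRank_concave hW hirr
  have hstep : ∀ j ≤ m, R (j + 2) + R j < 2 * R (j + 1) ∨ R j + R 1 ≤ R (j + 1) := by
    intro j hj
    by_contra! hcon
    obtain ⟨x, hx, hx'⟩ := ((eventually_spanOn_eq_top_of_stall hmod hirr hinv
      (le_antisymm (hconc j) hcon.1) hcon.2).and (hrank j)).exists
    rw [hx, finrank_top, Module.finrank_fin_fun] at hx'
    have := monotone_nat_of_le_succ hmono hj
    lia
  have hpos : ∀ j ≤ m, R j < R (j + 1) := by
    intro j hj
    have h1 := hmono (j + 1)
    have h2 := hmono j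
    rcases hstep j hj with h | h <;> lia
  have hfin := mul_sub_le_of_increments hNm hmono hpos
    (fun j hj => (hstep j hj).imp_right fun h => by lia) hconc
  rw [Nat.mul_sub, ← sq] at hfin
  lia
end
end

section
/- (Lower bound on the generic rank.) Let V ⊆ ℂ^D be a nonempty Zariski-closed subset with dim V = N for a natural number N, and let m ≥ 1. If the m-th secant variety σ_m V equals all of ℂ^D, then m * N ≥ D. -/
noncomputable section

open MvPolynomial

/-- The non-vanishing loci of polynomials form a neighbourhood basis for the Zariski topology. -/
lemma exists_eval_ne_zero_subset_of_isOpen {ι : Type*} {U : Set (ι → ℂ)}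
    (hU : @IsOpen _ (zt ι) U) {x : ι → ℂ} (hx : x ∈ U) :
    ∃ f : MvPolynomial ι ℂ, eval x f ≠ 0 ∧ ∀ y, eval y f ≠ 0 → y ∈ U := by
  let := zt ι
  have hb := TopologicalSpace.isTopologicalBasis_of_subbasis_of_inter
    (t := zt ι) (r := { U | ∃ f : MvPolynomial ι ℂ, U = { x | eval x f ≠ 0 } }) rfl (by
      rintro _ ⟨f, rfl⟩ _ ⟨g, rfl⟩
      exact ⟨f * g, by ext; simp⟩)
  obtain ⟨W, hW, hxW, hWU⟩ := hb.exists_subset_of_mem_open hx hU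
  rcases hW with rfl | ⟨f, rfl⟩
  · exact ⟨1, by simp, fun y _ => hWU trivial⟩
  · exact ⟨f, hxW, fun y hy => hWU hy⟩

lemma zIsClosed_setOf_eval_eq_zero {ι : Type*} (f : MvPolynomial ι ℂ) :
    zIsClosed { x | eval x f = 0 } := by
  let := zt ι
  exact ⟨TopologicalSpace.isOpen_generateFrom_of_mem ⟨f, rfl⟩⟩

lemma zIsClosed_zeroLocus {ι : Type*} (I : Ideal (MvPolynomial ι ℂ)) :
    zIsClosed (zeroLocus ℂ I) := by
  let := zt ι
  have h : zeroLocus ℂ I = ⋂ f ∈ I, { x | eval x f = 0 } := by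
    ext x
    simp [aeval_eq_eval]
  rw [h]
  exact isClosed_biInter fun f _ => zIsClosed_setOf_eval_eq_zero f

lemma zIsClosed.zeroLocus_vanishingIdeal {ι : Type*} {V : Set (ι → ℂ)} (hV : zIsClosed V) :
    zeroLocus ℂ (vanishingIdeal ℂ V) = V := by
  let := zt ι
  refine subset_antisymm (fun x hx => ?_) (zeroLocus_vanishingIdeal_le V)
  by_contra hxV
  obtain ⟨f, hfx, hf⟩ := exists_eval_ne_zero_subset_of_isOpen hV.isOpen_compl hxV
  refine hfx (hx f fun y hy => ?_)
  by_contra hy'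
  exact hf y hy' hy

/-- The zero locus of a prime ideal is irreducible. -/
lemma zIsIrreducible_zeroLocus {ι : Type*} [Finite ι] (P : Ideal (MvPolynomial ι ℂ))
    [hP : P.IsPrime] : zIsIrreducible (zeroLocus ℂ P) := by
  let := zt ι
  have key (f : MvPolynomial ι ℂ) (hf : f ∉ P) : ∃ x ∈ zeroLocus ℂ P, eval x f ≠ 0 := by
    by_contra! h
    exact hf (IsPrime.vanishingIdeal_zeroLocus (K := ℂ) P ▸ h)
  refine ⟨(key 1 P.one_notMem).imp fun _ h => h.1, ?_⟩
  rintro U W hU hW ⟨x, hxP, hxU⟩ ⟨y, hyP, hyW⟩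
  obtain ⟨f, hfx, hf⟩ := exists_eval_ne_zero_subset_of_isOpen hU hxU
  obtain ⟨g, hgy, hg⟩ := exists_eval_ne_zero_subset_of_isOpen hW hyW
  obtain ⟨z, hzP, hz⟩ := key (f * g)
    (hP.mul_notMem (fun h => hfx (hxP f h)) (fun h => hgy (hyP g h)))
  rw [map_mul] at hz
  exact ⟨z, hzP, hf z (left_ne_zero_of_mul hz), hg z (right_ne_zero_of_mul hz)⟩

/-- The Krull dimension of the coordinate ring of an affine variety is at most the dimension
of the variety. -/
lemma ringKrullDim_quotient_vanishingIdeal_le_zDim {ι : Type*} [Finite ι] {V : Set (ι → ℂ)}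
    (hV : zIsClosed V) :
    ringKrullDim (MvPolynomial ι ℂ ⧸ vanishingIdeal ℂ V) ≤ zDim V := by
  let := zt ι
  let π := Ideal.Quotient.mk (vanishingIdeal ℂ V)
  let Z (P : PrimeSpectrum (MvPolynomial ι ℂ ⧸ vanishingIdeal ℂ V)) : Set (ι → ℂ) :=
    zeroLocus ℂ (P.asIdeal.comap π)
  have hZV (P) : Z P ⊆ V := by
    rw [← hV.zeroLocus_vanishingIdeal]
    refine zeroLocus_anti_mono fun f hf => ?_
    rw [Ideal.mem_comap, Ideal.Quotient.eq_zero_iff_mem.mpr hf]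
    exact zero_mem _
  have hZ (P) : IsIrreducible (Subtype.val ⁻¹' Z P : Set V) := by
    obtain ⟨⟨x, hx⟩, h⟩ := zIsIrreducible_zeroLocus (P.asIdeal.comap π)
    refine ⟨⟨⟨x, hZV P hx⟩, hx⟩, ?_⟩
    rintro _ _ ⟨U, hU, rfl⟩ ⟨W, hW, rfl⟩ ⟨a, haZ, haU⟩ ⟨b, hbZ, hbW⟩
    obtain ⟨z, hzZ, hzU, hzW⟩ := h U W hU hW ⟨a, haZ, haU⟩ ⟨b, hbZ, hbW⟩
    exact ⟨⟨z, hZV P hzZ⟩, hzZ, hzU, hzW⟩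
  have hZclosed (P) : IsClosed (Subtype.val ⁻¹' Z P : Set V) :=
    isClosed_induced_iff.mpr ⟨Z P, zIsClosed_zeroLocus _, rfl⟩
  let F (P : (PrimeSpectrum (MvPolynomial ι ℂ ⧸ vanishingIdeal ℂ V))ᵒᵈ) :
      TopologicalSpace.IrreducibleCloseds V :=
    ⟨Subtype.val ⁻¹' Z P.ofDual, hZ _, hZclosed _⟩
  have hF (P Q) : F P ≤ F Q ↔ P ≤ Q := by
    have hFZ : F P ≤ F Q ↔ Z P.ofDual ⊆ Z Q.ofDual := by
      change (Subtype.val ⁻¹' Z P.ofDual : Set V) ⊆ Subtype.val ⁻¹' Z Q.ofDual ↔ _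
      refine ⟨fun h x hx => ?_, fun h => Set.preimage_mono h⟩
      exact @h ⟨x, hZV _ hx⟩ hx
    rw [hFZ, ← OrderDual.ofDual_le_ofDual, ← PrimeSpectrum.asIdeal_le_asIdeal,
      ← Ideal.comap_le_comap_iff_of_surjective π Ideal.Quotient.mk_surjective]
    refine ⟨fun h => ?_, fun h => zeroLocus_anti_mono h⟩
    have hvan := vanishingIdeal_anti_mono (k := ℂ) h
    rwa [IsPrime.vanishingIdeal_zeroLocus, IsPrime.vanishingIdeal_zeroLocus] at hvan
  rw [ringKrullDim, ← Order.krullDim_orderDual]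
  exact Order.krullDim_le_of_strictMono F fun P Q h =>
    lt_of_le_not_ge ((hF _ _).mpr h.le) fun h' => h.not_ge ((hF _ _).mp h')

/-- Going up: an injective integral ring extension does not decrease the Krull dimension. -/
lemma ringKrullDim_le_of_isIntegral_of_injective {R S : Type*} [CommRing R] [CommRing S]
    (f : R →+* S) (hf : f.IsIntegral) (hinj : Function.Injective f) :
    ringKrullDim R ≤ ringKrullDim S := by
  algebraize [f]
  refine iSup_le fun l => ?_
  obtain ⟨P, -, hP, hPl⟩ := Ideal.exists_ideal_over_prime_of_isIntegral
    l.head.asIdeal (⊥ : Ideal S) (by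
      rw [← RingHom.ker_eq_comap_bot, RingHom.algebraMap_toAlgebra,
        (RingHom.injective_iff_ker_eq_bot f).mp hinj]
      exact bot_le)
  have : P.LiesOver l.head.asIdeal := ⟨hPl.symm⟩
  obtain ⟨L, hL, -, -⟩ := Ideal.exists_ltSeries_of_hasGoingUp l P
  rw [← hL]
  exact Order.LTSeries.length_le_krullDim L

/-- Algebraically independent elements of a domain that are integral over the subalgebra
generated by a finite family are at most as many as the members of that family. -/
lemma AlgebraicIndependent.card_le_of_isIntegral_adjoin_of_isDomain {K A ι κ : Type*} [Field K]
    [CommRing A] [IsDomain A] [Algebra K A] [Fintype ι] [Fintype κ] {y : ι → A} {t : κ → A}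
    (hy : AlgebraicIndependent K y)
    (hyt : ∀ i, IsIntegral (Algebra.adjoin K (Set.range t)) (y i)) :
    Fintype.card ι ≤ Fintype.card κ := by
  have hsub : Set.range y ⊆ (matroid K A).closure (Set.range t) := by
    rw [matroid_closure_eq]
    rintro _ ⟨i, rfl⟩
    exact (hyt i).isAlgebraic
  have hcard := (matroid_indep_iff.mpr hy.to_subtype_range).encard_le_eRk_of_subset hsub
  rw [Matroid.eRk_closure_eq] at hcard
  have h := hcard.trans ((Matroid.eRk_le_encard _ _).trans
    (Set.image_univ ▸ Set.encard_image_le t Set.univ))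
  rw [← Set.image_univ, hy.injective.encard_image] at h
  simpa using h

/-- Algebraically independent elements that are integral over the subalgebra generated by a
finite family are at most as many as the members of that family. -/
lemma AlgebraicIndependent.card_le_of_isIntegral_adjoin {K A ι κ : Type*} [Field K]
    [CommRing A] [Algebra K A] [Fintype ι] [Fintype κ] {y : ι → A} {t : κ → A}
    (hy : AlgebraicIndependent K y)
    (hyt : ∀ i, IsIntegral (Algebra.adjoin K (Set.range t)) (y i)) :
    Fintype.card ι ≤ Fintype.card κ := by
  obtain ⟨P, hP, -, hdisj⟩ := Ideal.exists_le_prime_disjoint (⊥ : Ideal A)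
    ((nonZeroDivisors (MvPolynomial ι K)).map (aeval y)) (by
      rw [Set.disjoint_left]
      rintro _ h0 ⟨f, hf, rfl⟩
      exact nonZeroDivisors.ne_zero hf ((map_eq_zero_iff _ hy).mp h0))
  let π := Ideal.Quotient.mkₐ K P
  have hy' : AlgebraicIndependent K (π ∘ y) := by
    rw [algebraicIndependent_iff]
    intro f hf
    by_contra hf0
    rw [show aeval (π ∘ y) f = π (aeval y f) from (comp_aeval_apply (f := y) π f).symm] at hf
    exact Set.disjoint_left.mp hdisj (Ideal.Quotient.eq_zero_iff_mem.mp hf)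
      ⟨f, mem_nonZeroDivisors_of_ne_zero hf0, rfl⟩
  refine hy'.card_le_of_isIntegral_adjoin_of_isDomain (t := π ∘ t) fun i => ?_
  let φ : Algebra.adjoin K (Set.range t) →ₐ[K] Algebra.adjoin K (Set.range (π ∘ t)) :=
    (π.comp (Subalgebra.val _)).codRestrict _ fun a => by
      rw [Set.range_comp, ← AlgHom.map_adjoin]
      exact ⟨a, a.2, rfl⟩
  exact (hyt i).map_of_comp_eq φ.toRingHom π.toRingHom rfl

/-- The image of an element integral over a polynomial algebra is integral over any subalgebra
containing the images of the variables. -/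
lemma RingHom.IsIntegralElem.isIntegral_of_forall_mem {K R A κ : Type*} [Field K]
    [CommRing R] [CommRing A] [Algebra K R] [Algebra K A] {g : MvPolynomial κ K →ₐ[K] R} {r : R}
    (hr : g.toRingHom.IsIntegralElem r) (φ : R →ₐ[K] A) (S : Subalgebra K A)
    (hS : ∀ k, φ (g (X k)) ∈ S) : _root_.IsIntegral S (φ r) := by
  let h : MvPolynomial κ K →ₐ[K] S := aeval fun k => ⟨φ (g (X k)), hS k⟩
  have hcomp : S.val.comp h = φ.comp g := by
    ext k
    simp [h]
  algebraize [g.toRingHom]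
  exact _root_.IsIntegral.map_of_comp_eq (R := MvPolynomial κ K) h.toRingHom φ.toRingHom
    (congrArg AlgHom.toRingHom hcomp) hr

theorem stmt_7 {D : ℕ}
    (V : Set (Fin D → ℂ))
    (hne : V.Nonempty) (hclosed : zIsClosed V)
    (N : ℕ) (hdim : zDim V = (N : WithBot ℕ∞))
    (m : ℕ) (hm : 1 ≤ m)
    (hfill : secant m V = Set.univ) :
    D ≤ m * N := by
  have hI : vanishingIdeal ℂ V ≠ ⊤ := fun h => by
    obtain ⟨x, hx⟩ := hne
    have h1 : (1 : MvPolynomial (Fin D) ℂ) ∈ vanishingIdeal ℂ V := h ▸ trivial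
    simpa using h1 x hx
  obtain ⟨s, -, g, hginj, hgint⟩ := exists_integral_inj_algHom_of_quotient _ hI
  have hsN : s ≤ N := by
    have h := (ringKrullDim_le_of_isIntegral_of_injective g.toRingHom hgint hginj).trans
      (ringKrullDim_quotient_vanishingIdeal_le_zDim hclosed)
    rw [hdim, MvPolynomial.ringKrullDim_of_isNoetherianRing, ringKrullDim_eq_zero_of_field] at h
    simpa using h
  -- `φ i f` is the function on `V ^ m` applying `f` to the `i`-th point.
  let φ (i : Fin m) :
      (MvPolynomial (Fin D) ℂ ⧸ vanishingIdeal ℂ V) →ₐ[ℂ] ((Fin m → V) → ℂ) :=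
    Ideal.Quotient.liftₐ _ (AlgHom.pi fun v => aeval (v i : Fin D → ℂ))
      fun f hf => funext fun v => hf _ (v i).2
  let x (j : Fin D) : MvPolynomial (Fin D) ℂ ⧸ vanishingIdeal ℂ V := Ideal.Quotient.mk _ (X j)
  have hφx (i j) (v : Fin m → V) : φ i (x j) v = (v i : Fin D → ℂ) j := by
    change aeval (v i : Fin D → ℂ) (X j : MvPolynomial (Fin D) ℂ) = _
    simp
  let y (j : Fin D) : (Fin m → V) → ℂ := ∑ i, φ i (x j)
  let t (p : Fin m × Fin s) : (Fin m → V) → ℂ := φ p.1 (g (X p.2))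
  have hy : AlgebraicIndependent ℂ y := by
    rw [algebraicIndependent_iff]
    intro f hf
    have hzero : secant m V ⊆ { p | eval p f = 0 } := by
      let := zt (Fin D)
      refine closure_minimal ?_ (zIsClosed_setOf_eval_eq_zero f)
      rintro _ ⟨v, hv, rfl⟩
      have h := congrFun hf fun i => ⟨v i, hv i⟩
      have hev := comp_aeval_apply (f := y)
        (Pi.evalAlgHom ℂ (fun _ : Fin m → V => ℂ) fun i => ⟨v i, hv i⟩) f
      have hsum : (fun j => (Pi.evalAlgHom ℂ (fun _ : Fin m → V => ℂ) fun i => ⟨v i, hv i⟩) (y j))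
          = ∑ i, v i := by
        ext j
        simp [y, hφx]
      rw [hsum] at hev
      exact hev.symm.trans h
    refine MvPolynomial.funext fun p => ?_
    rw [map_zero]
    exact hzero (hfill ▸ Set.mem_univ p)
  have hcard := hy.card_le_of_isIntegral_adjoin (t := t) fun j =>
    IsIntegral.sum _ fun i _ => (hgint (x j)).isIntegral_of_forall_mem (φ i) _
      fun k => Algebra.subset_adjoin ⟨(i, k), rfl⟩
  simp only [Fintype.card_fin, Fintype.card_prod] at hcard
  exact hcard.trans (Nat.mul_le_mul_left m hsN)
end
end
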